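/- Let M > K ≥ 1 and let X be a random M×K complex matrix whose entries are mutually independent, with every entry in column k distributed as CN(0, d_k) where d_k > 0. Then for each k, E{ [ (X^H X)^{-1} ]_{kk} } = 1 / ( (M−K) · d_k ). -/

import Mathlib

open MeasureTheory ProbabilityTheory Matrix Filter

/-- Matrices inherit the (pi) measurable structure of functions. -/
instance matrixMeasurableSpace {m n α : Type*} [MeasurableSpace α] :
    MeasurableSpace (Matrix m n α) :=
  inferInstanceAs (MeasurableSpace (m → n → α))

/-- The circularly-symmetric complex Gaussian distribution `CN(0, v)`:
real and imaginary parts are independent real Gaussians, each of variance `v/2`. -/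
noncomputable def complexGaussian (v : ℝ) : Measure ℂ :=
  Measure.map (fun p : ℝ × ℝ => ⟨p.1, p.2⟩)
    ((gaussianReal 0 (v / 2).toNNReal).prod (gaussianReal 0 (v / 2).toNNReal))


lemma cg_meas : Measurable (fun p : ℝ × ℝ => (⟨p.1, p.2⟩ : ℂ)) :=
  Complex.measurableEquivRealProd.symm.measurable

instance cg_prob (v : ℝ) : IsProbabilityMeasure (complexGaussian v) :=
  Measure.isProbabilityMeasure_map cg_meas.aemeasurable

lemma cg_charFun (v : ℝ) (hv : 0 < v) (t : ℂ) :
    charFun (complexGaussian v) t = Complex.exp (-(v * ‖t‖ ^ 2 / 4 : ℝ)) := by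
  have h (x : ℝ × ℝ) : Complex.exp (↑(inner ℝ (⟨x.1, x.2⟩ : ℂ) t) * Complex.I)
      = Complex.exp (↑(inner ℝ x.1 t.re) * Complex.I) *
        Complex.exp (↑(inner ℝ x.2 t.im) * Complex.I) := by
    rw [← Complex.exp_add, Complex.inner]
    congr 1
    simp [Complex.mul_re]
    ring
  have h1 := charFun_gaussianReal (μ := 0) (v := (v/2).toNNReal) t.re
  have h2 := charFun_gaussianReal (μ := 0) (v := (v/2).toNNReal) t.im
  rw [charFun_apply] at h1 h2
  rw [charFun_apply, complexGaussian, integral_map cg_meas.aemeasurable (by fun_prop)]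
  simp_rw [h]
  rw [integral_prod_mul (fun x : ℝ => Complex.exp (↑(inner ℝ x t.re) * Complex.I))
    (fun x : ℝ => Complex.exp (↑(inner ℝ x t.im) * Complex.I)), h1, h2, ← Complex.exp_add]
  congr 1
  rw [← Complex.normSq_eq_norm_sq, Complex.normSq_apply, Real.coe_toNNReal _ (by positivity)]
  push_cast
  ring

lemma gr_exp (v : ℝ) (hv : 0 < v) (s : ℝ) (hs : 0 ≤ s) :
    ∫ x, Real.exp (-s * x ^ 2) ∂(gaussianReal 0 v.toNNReal) = (√(1 + 2 * s * v))⁻¹ := by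
  rw [integral_gaussianReal_eq_integral_smul (by simpa using hv)]
  have h (x : ℝ) : gaussianPDFReal 0 v.toNNReal x • Real.exp (-s * x ^ 2)
      = (√(2 * Real.pi * v))⁻¹ * Real.exp (-(s + 1 / (2 * v)) * x ^ 2) := by
    rw [gaussianPDFReal, Real.coe_toNNReal _ hv.le, smul_eq_mul, mul_assoc, ← Real.exp_add]
    congr 2
    field_simp
    ring
  simp_rw [h]
  rw [integral_const_mul, integral_gaussian, ← Real.sqrt_inv, ← Real.sqrt_inv,
    ← Real.sqrt_mul (by positivity)]
  congr 1
  have := Real.pi_pos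
  have h3 : 0 < 1 + 2 * s * v := by positivity
  have h4 : 0 < s + 1 / (2 * v) := by positivity
  field_simp
  ring

lemma cg_exp (v : ℝ) (hv : 0 < v) (s : ℝ) (hs : 0 ≤ s) :
    ∫ z, Real.exp (-s * ‖z‖ ^ 2) ∂(complexGaussian v) = (1 + s * v)⁻¹ := by
  rw [complexGaussian, integral_map cg_meas.aemeasurable (by fun_prop)]
  have h (x : ℝ × ℝ) : Real.exp (-s * ‖(⟨x.1, x.2⟩ : ℂ)‖ ^ 2)
      = Real.exp (-s * x.1 ^ 2) * Real.exp (-s * x.2 ^ 2) := by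
    rw [← Real.exp_add, ← Complex.normSq_eq_norm_sq, Complex.normSq_apply]
    congr 1
    ring
  simp_rw [h]
  rw [integral_prod_mul (fun x : ℝ => Real.exp (-s * x ^ 2)) (fun x : ℝ => Real.exp (-s * x ^ 2)),
    gr_exp _ (by positivity) s hs, ← mul_inv, Real.mul_self_sqrt (by positivity)]
  congr 1
  ring

lemma pi_exp (M : ℕ) (v : ℝ) (hv : 0 < v) (l : Fin M → ℝ) (hl : ∀ i, 0 ≤ l i) :
    ∫⁻ y, ENNReal.ofReal (Real.exp (- ∑ i, l i * ‖y i‖ ^ 2))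
      ∂(Measure.pi (fun _ : Fin M => complexGaussian v)) = ENNReal.ofReal (∏ i, (1 + l i * v)⁻¹) := by
  rw [← ofReal_integral_eq_lintegral_ofReal]
  · congr 1
    have h (y : Fin M → ℂ) : Real.exp (- ∑ i, l i * ‖y i‖ ^ 2)
        = ∏ i, Real.exp (- l i * ‖y i‖ ^ 2) := by
      rw [← Real.exp_sum, ← Finset.sum_neg_distrib]
      simp
    simp_rw [h]
    rw [integral_fintype_prod_eq_prod (fun i (z : ℂ) => Real.exp (- l i * ‖z‖ ^ 2))]
    exact Finset.prod_congr rfl fun i _ => cg_exp v hv _ (hl i)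
  · refine Integrable.of_bound (C := 1) (Continuous.aestronglyMeasurable (by fun_prop)) (ae_of_all _ fun y => ?_)
    rw [Real.norm_eq_abs, Real.abs_exp, Real.exp_le_one_iff, neg_nonpos]
    exact Finset.sum_nonneg fun i _ => mul_nonneg (hl i) (by positivity)
  · exact ae_of_all _ fun y => (Real.exp_pos _).le

lemma pi_rot (M : ℕ) (v : ℝ) (hv : 0 < v)
    (L : EuclideanSpace ℂ (Fin M) ≃ₗᵢ[ℂ] EuclideanSpace ℂ (Fin M)) :
    (Measure.pi (fun _ : Fin M => complexGaussian v)).map (fun x => L (WithLp.toLp 2 x))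
      = (Measure.pi (fun _ : Fin M => complexGaussian v)).map (WithLp.toLp 2) := by
  let L' : EuclideanSpace ℂ (Fin M) ≃ₗᵢ[ℝ] EuclideanSpace ℂ (Fin M) :=
    { L.toLinearEquiv.restrictScalars ℝ with norm_map' := L.norm_map }
  have hL' : ∀ x, L x = L' x := fun x => rfl
  have hm : Measurable (fun x : EuclideanSpace ℂ (Fin M) => L x) := L.continuous.measurable
  have hm2 : Measurable (WithLp.toLp 2 : (Fin M → ℂ) → _) :=
    (MeasurableEquiv.toLp 2 (Fin M → ℂ)).measurable
  have : IsProbabilityMeasure ((Measure.pi (fun _ : Fin M => complexGaussian v)).map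
    (WithLp.toLp 2)) := Measure.isProbabilityMeasure_map hm2.aemeasurable
  have : IsProbabilityMeasure (((Measure.pi (fun _ : Fin M => complexGaussian v)).map
    (WithLp.toLp 2)).map L) := Measure.isProbabilityMeasure_map hm.aemeasurable
  change Measure.map (L ∘ _) _ = _
  rw [← Measure.map_map hm hm2]
  have key (t : EuclideanSpace ℂ (Fin M)) : charFun ((Measure.pi
      (fun _ : Fin M => complexGaussian v)).map (WithLp.toLp 2)) t
      = Complex.exp (-(v * ‖t‖ ^ 2 / 4 : ℝ)) := by
    rw [charFun_pi]
    simp_rw [cg_charFun v hv]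
    rw [← Complex.exp_sum, EuclideanSpace.norm_sq_eq]
    push_cast
    rw [Finset.sum_neg_distrib, Finset.mul_sum, Finset.sum_div]
  apply Measure.ext_of_charFun
  funext t
  rw [key, charFun_apply, integral_map hm.aemeasurable (by fun_prop)]
  have h (x : EuclideanSpace ℂ (Fin M)) : inner ℝ (L x) t = inner ℝ x (L'.symm t) := by
    rw [hL', ← L'.inner_map_map x, L'.apply_symm_apply]
  simp_rw [h]
  rw [← charFun_apply, key, L'.symm.norm_map]

lemma quad_eq {M : ℕ} (P : Matrix (Fin M) (Fin M) ℂ) (hP : P.IsHermitian) (x : Fin M → ℂ) :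
    star x ⬝ᵥ (P *ᵥ x) = ((∑ i, hP.eigenvalues i *
      ‖(hP.eigenvectorBasis.repr (WithLp.toLp 2 x)) i‖ ^ 2 : ℝ) : ℂ) := by
  have h1 : star x ⬝ᵥ (P *ᵥ x) = inner ℂ (WithLp.toLp 2 x) (WithLp.toLp 2 (P *ᵥ x)) := by
    rw [EuclideanSpace.inner_eq_star_dotProduct, dotProduct_comm]
  have h2 (i : Fin M) : inner ℂ (hP.eigenvectorBasis i) (WithLp.toLp 2 (P *ᵥ x))
      = hP.eigenvalues i * inner ℂ (hP.eigenvectorBasis i) (WithLp.toLp 2 x) := by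
    rw [EuclideanSpace.inner_eq_star_dotProduct, EuclideanSpace.inner_eq_star_dotProduct]
    change P *ᵥ x ⬝ᵥ _ = _ * (x ⬝ᵥ _)
    rw [dotProduct_comm, dotProduct_mulVec]
    have : star (hP.eigenvectorBasis i).ofLp ᵥ* P = star (P *ᵥ (hP.eigenvectorBasis i).ofLp) := by
      rw [star_mulVec, hP.eq]
    rw [this, hP.mulVec_eigenvectorBasis, dotProduct_comm]
    simp [dotProduct_smul]
  rw [h1, ← hP.eigenvectorBasis.sum_inner_mul_inner]
  push_cast
  refine Finset.sum_congr rfl fun i _ => ?_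
  rw [h2, hP.eigenvectorBasis.repr_apply_apply, ← Complex.conj_mul', inner_conj_symm]
  ring

lemma eig_idem {M : ℕ} (P : Matrix (Fin M) (Fin M) ℂ) (hP : P.IsHermitian) (hPP : P * P = P)
    (i : Fin M) : hP.eigenvalues i = 0 ∨ hP.eigenvalues i = 1 := by
  have h := hP.mulVec_eigenvectorBasis i
  have h2 : P *ᵥ (P *ᵥ (hP.eigenvectorBasis i).ofLp) = P *ᵥ (hP.eigenvectorBasis i).ofLp := by
    rw [mulVec_mulVec, hPP]
  rw [h, mulVec_smul, h, smul_smul] at h2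
  have hne : (hP.eigenvectorBasis i).ofLp ≠ 0 := by
    intro h0
    have := hP.eigenvectorBasis.orthonormal.ne_zero i
    exact this (by ext j; simp [h0])
  have h3 := smul_left_injective ℝ hne h2
  have : hP.eigenvalues i * (hP.eigenvalues i - 1) = 0 := by linarith
  rcases mul_eq_zero.1 this with h | h
  · exact Or.inl h
  · exact Or.inr (by linarith)

lemma proj_exp {M : ℕ} (P : Matrix (Fin M) (Fin M) ℂ) (hP : P.IsHermitian) (hPP : P * P = P)
    (N : ℕ) (htr : P.trace = N) (v : ℝ) (hv : 0 < v) (t : ℝ) (ht : 0 ≤ t) :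
    ∫⁻ x, ENNReal.ofReal (Real.exp (- (star x ⬝ᵥ (P *ᵥ x)).re * t))
      ∂(Measure.pi (fun _ : Fin M => complexGaussian v)) =
      ENNReal.ofReal ((1 + t * v) ^ N)⁻¹ := by
  have h0 (i) : 0 ≤ hP.eigenvalues i := by
    rcases eig_idem P hP hPP i with h | h <;> simp [h]
  have hm2 : Measurable (WithLp.toLp 2 : (Fin M → ℂ) → _) :=
    (MeasurableEquiv.toLp 2 (Fin M → ℂ)).measurable
  have hm : Measurable (fun x : Fin M → ℂ => hP.eigenvectorBasis.repr (WithLp.toLp 2 x)) :=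
    hP.eigenvectorBasis.repr.continuous.measurable.comp hm2
  have h1 := pi_exp M v hv (fun i => t * hP.eigenvalues i) (fun i => mul_nonneg ht (h0 i))
  have hmf : Measurable (fun y : EuclideanSpace ℂ (Fin M) =>
      ENNReal.ofReal (Real.exp (- ∑ i, t * hP.eigenvalues i * ‖y i‖ ^ 2))) :=
    ENNReal.measurable_ofReal.comp (Continuous.measurable (by fun_prop))
  have h2 : ∏ i, (1 + t * hP.eigenvalues i * v)⁻¹ = ((1 + t * v) ^ N)⁻¹ := by
    rw [Finset.prod_inv_distrib]
    congr 1
    have hs : ∑ i, hP.eigenvalues i = N := by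
      have := hP.trace_eq_sum_eigenvalues
      rw [htr] at this
      have h := congrArg Complex.re this
      simpa using h.symm
    have hp : 0 < 1 + t * v := by positivity
    rw [← Real.rpow_natCast, ← hs, Real.rpow_sum_of_pos hp]
    refine Finset.prod_congr rfl fun i _ => ?_
    rcases eig_idem P hP hPP i with h | h <;> simp [h]
  rw [← h2, ← h1]
  have h3 : ∫⁻ y, ENNReal.ofReal (Real.exp (- ∑ i, t * hP.eigenvalues i * ‖y i‖ ^ 2))
      ∂((Measure.pi (fun _ : Fin M => complexGaussian v)).map
        (fun x => hP.eigenvectorBasis.repr (WithLp.toLp 2 x))) = 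
      ∫⁻ y, ENNReal.ofReal (Real.exp (- ∑ i, t * hP.eigenvalues i * ‖y i‖ ^ 2))
      ∂((Measure.pi (fun _ : Fin M => complexGaussian v)).map (WithLp.toLp 2)) := by
    rw [pi_rot M v hv]
  rw [lintegral_map hmf hm, lintegral_map hmf hm2] at h3
  rw [← h3]
  refine lintegral_congr fun x => ?_
  rw [quad_eq P hP, Complex.ofReal_re, ← Finset.sum_neg_distrib, Finset.sum_mul,
    ← Finset.sum_neg_distrib]
  congr 2
  refine Finset.sum_congr rfl fun i _ => ?_
  ring

lemma int_pow (n : ℕ) (v : ℝ) (hv : 0 < v) :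
    ∫⁻ t in Set.Ioi (0 : ℝ), ENNReal.ofReal ((1 + t * v) ^ (n + 2))⁻¹
      = ENNReal.ofReal (1 / ((n + 1) * v)) := by
  let g : ℝ → ℝ := fun t => - (((n + 1) * v)⁻¹ * ((1 + t * v) ^ (n + 1))⁻¹)
  have hg : ∀ x ∈ Set.Ici (0 : ℝ), HasDerivAt g (((1 + x * v) ^ (n + 2))⁻¹) x := by
    intro x hx
    have hx : 0 ≤ x := hx
    have hp : 0 < 1 + x * v := by positivity
    have h1 : HasDerivAt (fun t : ℝ => 1 + t * v) v x := by
      simpa using ((hasDerivAt_id x).mul_const v).const_add 1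
    have h2 := (((h1.pow (n + 1)).inv (pow_pos hp _).ne').const_mul (((n + 1) * v)⁻¹)).neg
    refine h2.congr_deriv ?_
    simp only [Nat.add_sub_cancel, Pi.pow_apply]
    push_cast
    field_simp
    ring
  have hnn : ∀ x ∈ Set.Ioi (0 : ℝ), 0 ≤ ((1 + x * v) ^ (n + 2))⁻¹ := by
    intro x hx
    have hx : 0 < x := hx
    positivity
  have hlim : Tendsto g atTop (nhds 0) := by
    have h1 : Tendsto (fun t : ℝ => 1 + t * v) atTop atTop :=
      tendsto_atTop_add_const_left _ _ (tendsto_id.atTop_mul_const hv)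
    have h2 := (((tendsto_pow_atTop (Nat.succ_ne_zero n)).comp h1).inv_tendsto_atTop.const_mul
      (((n + 1) * v)⁻¹)).neg
    simpa [g, Function.comp_def] using h2
  have hI := integrableOn_Ioi_deriv_of_nonneg' hg hnn hlim
  rw [← ofReal_integral_eq_lintegral_ofReal hI, integral_Ioi_of_hasDerivAt_of_nonneg' hg hnn hlim]
  · simp [g]
  · exact (ae_restrict_iff' measurableSet_Ioi).2 (ae_of_all _ hnn)

lemma int_exp (q : ℝ) (hq : 0 < q) :
    ∫⁻ t in Set.Ioi (0 : ℝ), ENNReal.ofReal (Real.exp (-q * t)) = ENNReal.ofReal q⁻¹ := by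
  have hI : IntegrableOn (fun t => Real.exp (-q * t)) (Set.Ioi 0) :=
    integrableOn_exp_mul_Ioi (by linarith) 0
  rw [← ofReal_integral_eq_lintegral_ofReal hI (ae_of_all _ fun _ => (Real.exp_pos _).le),
    integral_exp_mul_Ioi (by linarith)]
  congr 1
  simp [neg_div_neg_eq]

lemma proj_key {M : ℕ} (P : Matrix (Fin M) (Fin M) ℂ) (hP : P.IsHermitian) (hPP : P * P = P)
    (n : ℕ) (htr : P.trace = (n + 2 : ℕ)) (v : ℝ) (hv : 0 < v) :
    (∀ᵐ x ∂(Measure.pi (fun _ : Fin M => complexGaussian v)), 0 < (star x ⬝ᵥ (P *ᵥ x)).re) ∧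
    ∫⁻ x, ENNReal.ofReal ((star x ⬝ᵥ (P *ᵥ x)).re)⁻¹
      ∂(Measure.pi (fun _ : Fin M => complexGaussian v)) =
      ENNReal.ofReal (1 / ((n + 1) * v)) := by
  have hmeas : Measurable (fun p : (Fin M → ℂ) × ℝ =>
      ENNReal.ofReal (Real.exp (- (star p.1 ⬝ᵥ (P *ᵥ p.1)).re * p.2))) := by
    refine ENNReal.measurable_ofReal.comp (Continuous.measurable ?_)
    unfold Matrix.mulVec dotProduct
    fun_prop
  have hmain : ∫⁻ x, (∫⁻ t in Set.Ioi (0 : ℝ),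
      ENNReal.ofReal (Real.exp (- (star x ⬝ᵥ (P *ᵥ x)).re * t)))
      ∂(Measure.pi (fun _ : Fin M => complexGaussian v)) =
      ENNReal.ofReal (1 / ((n + 1) * v)) := by
    rw [lintegral_lintegral_swap hmeas.aemeasurable, ← int_pow n v hv]
    refine setLIntegral_congr_fun measurableSet_Ioi fun t ht => ?_
    exact proj_exp P hP hPP (n + 2) htr v hv t (le_of_lt ht)
  have hpos : ∀ᵐ x ∂(Measure.pi (fun _ : Fin M => complexGaussian v)),
      0 < (star x ⬝ᵥ (P *ᵥ x)).re := by
    have hfin := ae_lt_top (μ := Measure.pi (fun _ : Fin M => complexGaussian v))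
      (f := fun x => ∫⁻ t in Set.Ioi (0 : ℝ),
        ENNReal.ofReal (Real.exp (- (star x ⬝ᵥ (P *ᵥ x)).re * t)))
      (Measurable.lintegral_prod_right' hmeas) (by rw [hmain]; exact ENNReal.ofReal_ne_top)
    filter_upwards [hfin] with x hx
    by_contra hcon
    have h1 : ∫⁻ t in Set.Ioi (0 : ℝ), (1 : ENNReal) ≤ ∫⁻ t in Set.Ioi (0 : ℝ),
        ENNReal.ofReal (Real.exp (- (star x ⬝ᵥ (P *ᵥ x)).re * t)) := by
      refine setLIntegral_mono' measurableSet_Ioi fun t ht => ?_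
      rw [ENNReal.one_le_ofReal, Real.one_le_exp_iff]
      exact mul_nonneg (by linarith) (le_of_lt ht)
    have := h1.trans_lt hx
    simp at this
  refine ⟨hpos, ?_⟩
  rw [← hmain]
  refine lintegral_congr_ae ?_
  filter_upwards [hpos] with x hx
  rw [int_exp _ hx]

/-- The Gram matrix of a family of columns. -/
def gramM {M K : ℕ} (c : Fin K → Fin M → ℂ) : Matrix (Fin K) (Fin K) ℂ :=
  ((Matrix.of c)ᵀ)ᴴ * (Matrix.of c)ᵀ

/-- Projection on the orthogonal complement of the columns. -/
noncomputable def projM {M K : ℕ} (c : Fin K → Fin M → ℂ) : Matrix (Fin M) (Fin M) ℂ :=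
  1 - (Matrix.of c)ᵀ * (gramM c)⁻¹ * ((Matrix.of c)ᵀ)ᴴ

lemma gramM_herm {M K : ℕ} (c : Fin K → Fin M → ℂ) : (gramM c).IsHermitian :=
  isHermitian_conjTranspose_mul_self _

lemma projM_herm {M K : ℕ} (c : Fin K → Fin M → ℂ) : (projM c).IsHermitian := by
  unfold projM
  refine isHermitian_one.sub ?_
  exact isHermitian_mul_mul_conjTranspose _ (gramM_herm c).inv

lemma projM_idem {M K : ℕ} (c : Fin K → Fin M → ℂ) (h : (gramM c).det ≠ 0) :
    projM c * projM c = projM c := by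
  have hu : IsUnit (gramM c).det := isUnit_iff_ne_zero.2 h
  have h1 : ((Matrix.of c)ᵀ * (gramM c)⁻¹ * ((Matrix.of c)ᵀ)ᴴ) *
      ((Matrix.of c)ᵀ * (gramM c)⁻¹ * ((Matrix.of c)ᵀ)ᴴ)
      = (Matrix.of c)ᵀ * (gramM c)⁻¹ * ((Matrix.of c)ᵀ)ᴴ := by
    calc _ = (Matrix.of c)ᵀ * ((gramM c)⁻¹ * (((Matrix.of c)ᵀ)ᴴ * (Matrix.of c)ᵀ)) *
          (gramM c)⁻¹ * ((Matrix.of c)ᵀ)ᴴ := by simp only [Matrix.mul_assoc]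
      _ = _ := by
          change (Matrix.of c)ᵀ * ((gramM c)⁻¹ * gramM c) * _ * _ = _
          rw [nonsing_inv_mul _ hu, Matrix.mul_one]
  unfold projM
  rw [sub_mul, mul_sub, mul_sub, h1]
  simp

lemma projM_trace {M K : ℕ} (c : Fin K → Fin M → ℂ) (h : (gramM c).det ≠ 0) :
    (projM c).trace = (M : ℂ) - K := by
  have hu : IsUnit (gramM c).det := isUnit_iff_ne_zero.2 h
  unfold projM
  rw [trace_sub, trace_mul_comm, ← Matrix.mul_assoc]
  change _ - (gramM c * _).trace = _
  rw [mul_nonsing_inv _ hu]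
  simp

lemma gram_det {M K : ℕ} (k : Fin (K + 1)) (c : Fin (K + 1) → Fin M → ℂ)
    (h : (gramM (fun j => c (k.succAbove j))).det ≠ 0) :
    (gramM c).det = (gramM (fun j => c (k.succAbove j))).det *
      (star (c k) ⬝ᵥ (projM (fun j => c (k.succAbove j)) *ᵥ c k)) := by
  set c' := fun j => c (k.succAbove j) with hc'
  have hu : IsUnit (gramM c').det := isUnit_iff_ne_zero.2 h
  let e : Fin K ⊕ Unit ≃ Fin (K + 1) :=
    ((finSuccEquiv' k).trans (Equiv.optionEquivSumPUnit (Fin K))).symm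
  have e1 (j) : e (Sum.inl j) = k.succAbove j := by simp [e]
  have e2 (j) : e (Sum.inr j) = k := by simp [e]
  have hb : (gramM c).submatrix e e = fromBlocks (gramM c')
      (((Matrix.of c')ᵀ)ᴴ * (Matrix.of (fun _ : Unit => c k))ᵀ)
      (((Matrix.of (fun _ : Unit => c k))ᵀ)ᴴ * (Matrix.of c')ᵀ)
      (((Matrix.of (fun _ : Unit => c k))ᵀ)ᴴ * (Matrix.of (fun _ : Unit => c k))ᵀ) := by
    ext i j
    rcases i with i | i <;> rcases j with j | j <;>
      simp [gramM, Matrix.mul_apply, e1, e2, hc']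
  let _ : Invertible (gramM c') := invertibleOfIsUnitDet _ hu
  rw [← det_submatrix_equiv_self e, hb, det_fromBlocks₁₁, invOf_eq_nonsing_inv]
  congr 1
  have : ((Matrix.of (fun _ : Unit => c k))ᵀ)ᴴ * (Matrix.of (fun _ : Unit => c k))ᵀ -
      ((Matrix.of (fun _ : Unit => c k))ᵀ)ᴴ * (Matrix.of c')ᵀ * (gramM c')⁻¹ *
        (((Matrix.of c')ᵀ)ᴴ * (Matrix.of (fun _ : Unit => c k))ᵀ) =
      ((Matrix.of (fun _ : Unit => c k))ᵀ)ᴴ * (projM c' * (Matrix.of (fun _ : Unit => c k))ᵀ) := by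
    unfold projM
    rw [Matrix.sub_mul, Matrix.mul_sub, Matrix.one_mul]
    simp only [Matrix.mul_assoc]
  rw [this, det_unique]
  simp [Matrix.mul_apply, dotProduct, mulVec]

lemma gram_inv {M K : ℕ} (k : Fin (K + 1)) (c : Fin (K + 1) → Fin M → ℂ) :
    (gramM c)⁻¹ k k = (gramM (fun j => c (k.succAbove j))).det / (gramM c).det := by
  rw [inv_def, Matrix.smul_apply, adjugate_fin_succ_eq_det_submatrix, Ring.inverse_eq_inv', smul_eq_mul,
    ← two_mul, pow_mul]
  have : (gramM c).submatrix k.succAbove k.succAbove = gramM (fun j => c (k.succAbove j)) := by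
    ext i j
    simp [gramM, Matrix.mul_apply]
  rw [this]
  simp [div_eq_inv_mul]

lemma gram_inv' {M K : ℕ} (k : Fin (K + 1)) (c : Fin (K + 1) → Fin M → ℂ)
    (h : (gramM (fun j => c (k.succAbove j))).det ≠ 0) :
    (gramM c)⁻¹ k k =
      (((star (c k) ⬝ᵥ (projM (fun j => c (k.succAbove j)) *ᵥ c k)).re⁻¹ : ℝ) : ℂ) := by
  rw [gram_inv, gram_det k c h, quad_eq _ (projM_herm _), Complex.ofReal_re]
  push_cast
  rw [div_mul_eq_div_div, div_self h, one_div]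

lemma gram_cont {M K : ℕ} : Continuous (fun c : Fin K → Fin M → ℂ => (gramM c).det) := by
  refine Continuous.matrix_det ?_
  refine continuous_matrix fun i j => ?_
  simp only [gramM, Matrix.mul_apply, conjTranspose_apply, transpose_apply, of_apply]
  fun_prop

/-- law of the columns -/
noncomputable def colLaw (M : ℕ) {K : ℕ} (d : Fin K → ℝ) : Measure (Fin K → Fin M → ℂ) :=
  Measure.pi (fun k => Measure.pi (fun _ : Fin M => complexGaussian (d k)))

instance colLaw_prob (M : ℕ) {K : ℕ} (d : Fin K → ℝ) : IsProbabilityMeasure (colLaw M d) := by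
  unfold colLaw; infer_instance

lemma colLaw_split (M : ℕ) {K : ℕ} (d : Fin (K + 1) → ℝ) (k : Fin (K + 1))
    (f : (Fin (K + 1) → Fin M → ℂ) → ENNReal) (hf : Measurable f) :
    ∫⁻ c, f c ∂(colLaw M d) = ∫⁻ y, (∫⁻ x, f (k.insertNth x y)
      ∂(Measure.pi (fun _ : Fin M => complexGaussian (d k))))
      ∂(colLaw M (fun j => d (k.succAbove j))) := by
  have h := (measurePreserving_piFinSuccAbove
    (fun k : Fin (K + 1) => Measure.pi (fun _ : Fin M => complexGaussian (d k))) k).symm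
  have h2 := h.lintegral_comp hf
  unfold colLaw
  rw [← h2, lintegral_prod_symm]
  · rfl
  · exact (hf.comp (MeasurableEquiv.measurable _)).aemeasurable

lemma gram_ae (M : ℕ) : ∀ (K : ℕ) (_ : K < M) (d : Fin K → ℝ) (_ : ∀ k, 0 < d k),
    ∀ᵐ c ∂(colLaw M d), (gramM c).det ≠ 0 := by
  intro K
  induction K with
  | zero => intro _ d _; exact ae_of_all _ fun c => by simp
  | succ K ih =>
    intro hK d hd
    have h1 := ih (by omega) (fun j => d ((0 : Fin (K + 1)).succAbove j)) (fun j => hd _)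
    have hms : MeasurableSet {c : Fin (K + 1) → Fin M → ℂ | (gramM c).det ≠ 0} :=
      gram_cont.measurable (measurableSet_singleton (0 : ℂ)).compl
    rw [ae_iff]
    change (colLaw M d) {c | (gramM c).det ≠ 0}ᶜ = 0
    rw [← lintegral_indicator_one hms.compl]
    rw [colLaw_split M d 0]
    · rw [lintegral_eq_zero_of_ae_eq_zero]
      filter_upwards [h1] with y hy
      rw [Pi.zero_apply]
      apply lintegral_eq_zero_of_ae_eq_zero
      have hkey := (proj_key (projM y) (projM_herm y) (projM_idem y hy) (M - K - 2) (by
        rw [projM_trace y hy]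
        have : M - K - 2 + 2 = M - K := by omega
        rw [this, Nat.cast_sub (by omega)]) (d 0) (hd 0)).1
      filter_upwards [hkey] with x hx
      simp only [Pi.zero_apply, Set.indicator_apply_eq_zero]
      intro hmem
      exfalso
      refine hmem ?_
      have hsub : (fun j => ((0 : Fin (K + 1)).insertNth x y : Fin (K + 1) → Fin M → ℂ)
        ((0 : Fin (K + 1)).succAbove j)) = y := by
        funext j; simp
      rw [Set.mem_setOf_eq, gram_det 0 _ (by rw [hsub]; exact hy), hsub, Fin.insertNth_apply_same]
      refine mul_ne_zero hy fun h0 => ?_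
      rw [h0] at hx
      simp at hx
    · exact measurable_one.indicator hms.compl

lemma main_lint (M K : ℕ) (hK : K + 1 < M) (d : Fin (K + 1) → ℝ) (hd : ∀ k, 0 < d k)
    (k : Fin (K + 1)) :
    ∫⁻ c, ENNReal.ofReal ((gramM c)⁻¹ k k).re ∂(colLaw M d)
      = ENNReal.ofReal (1 / (((M : ℝ) - (K + 1)) * d k)) := by
  have h1 := gram_ae M K (by omega) (fun j => d (k.succAbove j)) (fun j => hd _)
  rw [colLaw_split M d k]
  · have : ∀ᵐ y ∂(colLaw M (fun j => d (k.succAbove j))),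
        ∫⁻ x, ENNReal.ofReal ((gramM (k.insertNth x y : Fin (K + 1) → Fin M → ℂ))⁻¹ k k).re
          ∂(Measure.pi (fun _ : Fin M => complexGaussian (d k)))
        = ENNReal.ofReal (1 / (((M : ℝ) - (K + 1)) * d k)) := by
      filter_upwards [h1] with y hy
      have hkey := (proj_key (projM y) (projM_herm y) (projM_idem y hy) (M - K - 2) (by
        rw [projM_trace y hy]
        have : M - K - 2 + 2 = M - K := by omega
        rw [this, Nat.cast_sub (by omega)]) (d k) (hd k)).2
      have hc : ((M - K - 2 : ℕ) : ℝ) + 1 = (M : ℝ) - (K + 1) := by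
        have : M - K - 2 + 1 + (K + 1) = M := by omega
        have := congrArg (Nat.cast : ℕ → ℝ) this
        push_cast at this
        linarith
      rw [hc] at hkey
      rw [← hkey]
      refine lintegral_congr fun x => ?_
      have hsub : (fun j => (k.insertNth x y : Fin (K + 1) → Fin M → ℂ)
        (k.succAbove j)) = y := by
        funext j; simp
      rw [gram_inv' k _ (by rw [hsub]; exact hy), hsub, Fin.insertNth_apply_same,
        Complex.ofReal_re]
    rw [lintegral_congr_ae this]
    simp
  · simp_rw [gram_inv]
    have h2 : Measurable (fun c : Fin (K + 1) → Fin M → ℂ =>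
        (gramM (fun j => c (k.succAbove j))).det) :=
      (gram_cont.comp (by fun_prop : Continuous (fun (c : Fin (K + 1) → Fin M → ℂ) j =>
        c (k.succAbove j)))).measurable
    exact ENNReal.measurable_ofReal.comp (Complex.measurable_re.comp
      (h2.div gram_cont.measurable))

open ComplexOrder in
lemma gram_inv_real {M K : ℕ} (k : Fin K) (c : Fin K → Fin M → ℂ) :
    0 ≤ (gramM c)⁻¹ k k := by
  have h : (gramM c)⁻¹.PosSemidef := (posSemidef_conjTranspose_mul_self _).inv
  exact h.diag_nonneg

open ComplexOrder in
lemma main_int (M K : ℕ) (hK : K + 1 < M) (d : Fin (K + 1) → ℝ) (hd : ∀ k, 0 < d k)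
    (k : Fin (K + 1)) :
    ∫ c, (gramM c)⁻¹ k k ∂(colLaw M d)
      = 1 / (((M : ℂ) - ((K + 1 : ℕ) : ℂ)) * d k) := by
  have h0 (c : Fin (K + 1) → Fin M → ℂ) :
      (gramM c)⁻¹ k k = ((((gramM c)⁻¹ k k).re : ℝ) : ℂ) := by
    have := Complex.nonneg_iff.1 (gram_inv_real k c)
    apply Complex.ext <;> simp [this.2.symm]
  have hm : Measurable (fun c : Fin (K + 1) → Fin M → ℂ => ((gramM c)⁻¹ k k).re) := by
    simp_rw [gram_inv]
    have h2 : Measurable (fun c : Fin (K + 1) → Fin M → ℂ =>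
        (gramM (fun j => c (k.succAbove j))).det) :=
      (gram_cont.comp (by fun_prop : Continuous (fun (c : Fin (K + 1) → Fin M → ℂ) j =>
        c (k.succAbove j)))).measurable
    exact Complex.measurable_re.comp (h2.div gram_cont.measurable)
  have hpos : 0 < ((M : ℝ) - (K + 1)) := by
    have : ((K + 1 : ℕ) : ℝ) < M := by exact_mod_cast hK
    push_cast at this
    linarith
  have hdk := hd k
  rw [integral_congr_ae (ae_of_all _ h0), integral_complex_ofReal,
    integral_eq_lintegral_of_nonneg_ae
      (ae_of_all _ fun c => (Complex.nonneg_iff.1 (gram_inv_real k c)).1)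
      hm.aestronglyMeasurable, main_lint M K hK d hd k, ENNReal.toReal_ofReal (by positivity)]
  push_cast
  rfl

lemma law_eq {Ω : Type*} [MeasurableSpace Ω] (μ : Measure Ω) [IsProbabilityMeasure μ]
    (M K : ℕ) (d : Fin K → ℝ)
    (X : Ω → Matrix (Fin M) (Fin K) ℂ) (hX : ∀ i k, Measurable (fun ω => X ω i k))
    (hindep : iIndepFun
      (fun (p : Fin M × Fin K) ω => X ω p.1 p.2) μ)
    (hdist : ∀ i k, μ.map (fun ω => X ω i k) = complexGaussian (d k)) :
    μ.map (fun ω k i => X ω i k) = colLaw M d := by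
  have h1 : iIndepFun (fun (p : Fin K × Fin M) ω => X ω p.2 p.1) μ :=
    hindep.precomp (g := fun p : Fin K × Fin M => (p.2, p.1))
      (fun p q h => by simpa [Prod.ext_iff, and_comm] using h)
  have h2 := (iIndepFun_iff_map_fun_eq_pi_map (fun p : Fin K × Fin M =>
    (hX p.2 p.1).aemeasurable)).1 h1
  simp_rw [hdist] at h2
  have h3 := Measure.infinitePi_map_curry (fun (k : Fin K) (_ : Fin M) => complexGaussian (d k))
  simp_rw [Measure.infinitePi_eq_pi] at h3
  unfold colLaw
  have hmm : Measurable (fun ω => fun p : Fin K × Fin M => X ω p.2 p.1) :=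
    measurable_pi_lambda _ fun p => hX p.2 p.1
  rw [← h3, ← h2]
  exact (Measure.map_map (MeasurableEquiv.curry (Fin K) (Fin M) ℂ).measurable hmm).symm

theorem stmt_1
    {Ω : Type*} [MeasurableSpace Ω] (μ : Measure Ω) [IsProbabilityMeasure μ]
    (M K : ℕ) (hK : 1 ≤ K) (hMK : K < M)
    (d : Fin K → ℝ) (hd : ∀ k, 0 < d k)
    (X : Ω → Matrix (Fin M) (Fin K) ℂ) (hX : Measurable X)
    (hindep : iIndepFun
      (fun (p : Fin M × Fin K) ω => X ω p.1 p.2) μ)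
    (hdist : ∀ i k, μ.map (fun ω => X ω i k) = complexGaussian (d k)) :
    ∀ k : Fin K, ∫ ω, (((X ω)ᴴ * X ω)⁻¹) k k ∂μ
        = 1 / ((((M : ℂ) - (K : ℂ))) * (d k : ℂ)) := by
  intro k
  have hX' : ∀ i k, Measurable (fun ω => X ω i k) := fun i k =>
    (measurable_pi_apply k).comp ((measurable_pi_apply i).comp
      (show Measurable (fun ω => (X ω : Fin M → Fin K → ℂ)) from hX))
  have hlaw := law_eq μ M K d X hX' hindep hdist
  obtain ⟨K, rfl⟩ : ∃ n, K = n + 1 := ⟨K - 1, by omega⟩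
  rw [← main_int M K hMK d hd k, ← hlaw, integral_map]
  · rfl
  · exact (measurable_pi_lambda _ fun k => measurable_pi_lambda _ fun i => hX' i k).aemeasurable
  · have h2 : Measurable (fun c : Fin (K + 1) → Fin M → ℂ =>
        (gramM (fun j => c (k.succAbove j))).det) :=
      (gram_cont.comp (by fun_prop : Continuous (fun (c : Fin (K + 1) → Fin M → ℂ) j =>
        c (k.succAbove j)))).measurable
    simp_rw [gram_inv]
    exact (h2.div gram_cont.measurable).aestronglyMeasurable
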